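/- Let $G=(V,E)$ be a finite simple graph with $|V| = n \ge 2$, $|E| = m \ge 1$ and h-index $h \ge 1$, let $h' \in [h/2, h]$, $\varepsilon_\mathcal{D} \in (0,1/2]$ and $\varepsilon_\mathcal{R} \in (0,1)$. Sample $q \ge \frac{c\, n \ln n}{h'\, \varepsilon_\mathcal{R}^2}$ vertices $v_1,\dots,v_q$ i.i.d. uniformly from $V$ and $r \ge \frac{c\, m \ln n}{h'\, \varepsilon_\mathcal{D}^2}$ edges $e_1,\dots,e_r$ i.i.d. uniformly from $E$, for a sufficiently large constant $c>0$. Define $\widehat{\deg}(v) = \frac{m}{r}|\{j : v \in e_j\}|$ and set, for each degree $d \in [n]$: $\widehat{C}(d) = \frac{n}{q}|\{i : \deg(v_i) \ge d\}|$ if $d \le h'$, and $\widehat{C}(d) = |\{v \in V : \widehat{\deg}(v) \ge d\}|$ if $d > h'$. Then with probability at least $1 - n^{-c'}$ for a constant $c' > 0$ depending on $c$, the output $\widehat{C}$ is an $(\varepsilon_\mathcal{D},\varepsilon_\mathcal{R})$-BMA of $C$, i.e., for every $d \in [n]$: $(1-\varepsilon_\mathcal{R})\,C\big((1+\varepsilon_\mathcal{D})d\big)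 \le \widehat{C}(d) \le (1+\varepsilon_\mathcal{R})\,C\big((1-\varepsilon_\mathcal{D})d\big)$. -/

import Mathlib

open MeasureTheory ProbabilityTheory

/-- The ccdh of a graph extended to real thresholds:
`C(t) = |{v ∈ V : deg(v) ≥ t}|`. -/
noncomputable def ccdhR {V : Type*} [Fintype V] (G : SimpleGraph V) [DecidableRel G.Adj]
    (t : ℝ) : ℕ :=
  {v : V | t ≤ (G.degree v : ℝ)}.ncard

/-- The ccdh of a graph: `C(d) = |{v ∈ V : deg(v) ≥ d}|`. -/
noncomputable def ccdh {V : Type*} [Fintype V] (G : SimpleGraph V) [DecidableRel G.Adj]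
    (d : ℕ) : ℕ :=
  {v : V | d ≤ G.degree v}.ncard

/-- The h-index of a graph: the largest `d ∈ [n]` with `C(d) ≥ d` (and `0` if none). -/
noncomputable def hIndex {V : Type*} [Fintype V] (G : SimpleGraph V) [DecidableRel G.Adj] : ℕ :=
  ((Finset.Icc 1 (Fintype.card V)).filter fun d => d ≤ ccdh G d).sup id

lemma iIndepFun_indicator_preimage {Ω ι α : Type*} [MeasurableSpace Ω]
    {μ : Measure Ω} {X : ι → Ω → α}
    (h : iIndepFun (m := fun _ => ⊤) X μ) (A : Set α) :
    iIndepFun (fun i => (X i ⁻¹' A).indicator fun _ => (1 : ℝ)) μ :=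
  h.comp (mγ := fun _ => inferInstance) (fun _ => A.indicator fun _ => (1 : ℝ))
    (fun _ => measurable_from_top)

section Sampling

variable {Ω : Type*} [MeasurableSpace Ω] {μ : Measure Ω} [IsProbabilityMeasure μ]

/-- A set whose outer measure and that of its complement add up to at most `1` is
null-measurable. -/
lemma nullMeasurableSet_of_measure_add_compl_le_one {A : Set Ω} (h : μ A + μ Aᶜ ≤ 1) :
    NullMeasurableSet A μ := by
  set T := toMeasurable μ A with hT
  set T' := toMeasurable μ Aᶜ with hT'
  have hsub : A ⊆ T := subset_toMeasurable μ A
  have hsub' : Aᶜ ⊆ T' := subset_toMeasurable μ Aᶜ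
  have hunion : T ∪ T' = Set.univ := by
    apply Set.eq_univ_of_univ_subset
    rw [← Set.union_compl_self A]
    exact Set.union_subset_union hsub hsub'
  have hadd := measure_union_add_inter (μ := μ) T (measurableSet_toMeasurable μ Aᶜ)
  rw [← hT', hunion, measure_univ, measure_toMeasurable, measure_toMeasurable] at hadd
  have hinter : μ (T ∩ T') = 0 := by
    have h1 : 1 + μ (T ∩ T') ≤ 1 + 0 := by rw [hadd, add_zero]; exact h
    exact nonpos_iff_eq_zero.mp ((ENNReal.add_le_add_iff_left ENNReal.one_ne_top).mp h1)
  have hdiff : μ (T \ A) = 0 :=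
    measure_mono_null (t := T ∩ T') (fun _ hx => ⟨hx.1, hsub' hx.2⟩) hinter
  refine ⟨T, measurableSet_toMeasurable μ A, ?_⟩
  exact (hsub.eventuallyLE).antisymm (ae_le_set.mpr hdiff)

/-- Preimages under a uniform sample from the finite set `S` are null-measurable and have the
expected probability, without any measurability assumption on the sample. -/
lemma uniform_preimage {α : Type*} {S : Set α} (hS : S.Finite) {X : Ω → α} (hX : ∀ ω, X ω ∈ S)
    (hunif : ∀ x ∈ S, μ {ω | X ω = x} = (S.ncard : ENNReal)⁻¹) (A : Set α) :
    NullMeasurableSet (X ⁻¹' A) μ ∧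
      μ.real (X ⁻¹' A) = ((S ∩ A).ncard : ℝ) / (S.ncard : ℝ) := by
  have hne : S.Nonempty := by
    exact (nonempty_of_isProbabilityMeasure μ).elim fun ω => ⟨X ω, hX ω⟩
  have hN : 0 < (S.ncard : ℝ) := by exact_mod_cast (Set.ncard_pos hS).mpr hne
  have key : ∀ B : Set α, μ.real (X ⁻¹' B) ≤ ((S ∩ B).ncard : ℝ) / (S.ncard : ℝ) := by
    intro B
    have hfin : (S ∩ B).Finite := hS.subset Set.inter_subset_left
    have hcov : X ⁻¹' B ⊆ ⋃ x ∈ hfin.toFinset, {ω | X ω = x} := by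
      intro ω hω
      simp only [Set.mem_iUnion, Set.Finite.mem_toFinset]
      exact ⟨X ω, ⟨hX ω, hω⟩, rfl⟩
    calc μ.real (X ⁻¹' B) ≤ μ.real (⋃ x ∈ hfin.toFinset, {ω | X ω = x}) :=
          measureReal_mono hcov (measure_ne_top _ _)
      _ ≤ ∑ x ∈ hfin.toFinset, μ.real {ω | X ω = x} := measureReal_biUnion_finset_le _ _
      _ = ∑ x ∈ hfin.toFinset, (S.ncard : ℝ)⁻¹ := by
          refine Finset.sum_congr rfl fun x hx => ?_
          rw [measureReal_def, hunif x (hfin.mem_toFinset.mp hx).1]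
          simp
      _ = _ := by
          rw [Finset.sum_const, nsmul_eq_mul, Set.ncard_eq_toFinset_card _ hfin, div_eq_mul_inv]
  have h1 := key A
  have h2 := key Aᶜ
  have hsum : ((S ∩ A).ncard : ℝ) / (S.ncard : ℝ) + ((S ∩ Aᶜ).ncard : ℝ) / (S.ncard : ℝ) = 1 := by
    rw [← add_div, div_eq_one_iff_eq hN.ne']
    have := Set.ncard_inter_add_ncard_sdiff_eq_ncard S A hS
    rw [Set.sdiff_eq] at this
    exact_mod_cast this
  have h3 : 1 ≤ μ.real (X ⁻¹' A) + μ.real (X ⁻¹' Aᶜ) := by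
    have := measureReal_union_le (μ := μ) (X ⁻¹' A) (X ⁻¹' Aᶜ)
    rwa [← Set.preimage_union, Set.union_compl_self, Set.preimage_univ, probReal_univ] at this
  refine ⟨nullMeasurableSet_of_measure_add_compl_le_one ?_, by linarith⟩
  rw [← Set.preimage_compl, ← ENNReal.ofReal_toReal (measure_ne_top μ (X ⁻¹' A)),
    ← ENNReal.ofReal_toReal (measure_ne_top μ (X ⁻¹' Aᶜ)),
    ← ENNReal.ofReal_add ENNReal.toReal_nonneg ENNReal.toReal_nonneg, ← ENNReal.ofReal_one]
  apply ENNReal.ofReal_le_ofReal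
  rw [← measureReal_def, ← measureReal_def]
  linarith

variable {N : ℕ} {E : Fin N → Set Ω} {p : ℝ}

lemma mgf_indicator_one {A : Set Ω} (hA : NullMeasurableSet A μ) (t : ℝ) :
    mgf (A.indicator fun _ => (1 : ℝ)) μ t = 1 + μ.real A * (Real.exp t - 1) := by
  have h : (fun ω => Real.exp (t * A.indicator (fun _ => (1 : ℝ)) ω))
      = fun ω => 1 + A.indicator (fun _ => Real.exp t - 1) ω := by
    funext ω
    by_cases hω : ω ∈ A <;> simp [hω]
  have hint : Integrable (A.indicator fun _ => Real.exp t - 1) μ :=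
    (integrable_const (μ := μ) (Real.exp t - 1)).indicator₀ hA
  rw [mgf, h, integral_add (integrable_const _) hint, integral_indicator₀ hA]
  simp

/-- Integrability and the moment generating function of the number of occurring events among
`N` independent events of probability `p`. -/
lemma mgf_count_le (hE : ∀ i, NullMeasurableSet (E i) μ)
    (hind : iIndepFun (fun i => (E i).indicator fun _ => (1 : ℝ)) μ)
    (hp : ∀ i, μ.real (E i) = p) (t : ℝ) :
    Integrable (fun ω => Real.exp (t * ({i | ω ∈ E i}.ncard : ℝ))) μ ∧
      mgf (fun ω => ({i | ω ∈ E i}.ncard : ℝ)) μ t ≤ Real.exp (N * p * (Real.exp t - 1)) := by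
  classical
  have hcount : (fun ω => ({i | ω ∈ E i}.ncard : ℝ))
      = ∑ i, (E i).indicator fun _ => (1 : ℝ) := by
    funext ω
    rw [Finset.sum_apply, Set.ncard_eq_toFinset_card']
    simp [Set.indicator_apply]
  have hmeas : ∀ i, AEMeasurable ((E i).indicator fun _ => (1 : ℝ)) μ := fun i =>
    (aemeasurable_indicator_const_iff 1).mpr (hE i)
  constructor
  · have hcm : AEMeasurable (fun ω => ({i | ω ∈ E i}.ncard : ℝ)) μ := by
      rw [hcount]
      exact Finset.aemeasurable_sum _ fun i _ => hmeas i
    refine Integrable.of_bound (C := Real.exp (|t| * N))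
      (Real.measurable_exp.comp_aemeasurable (hcm.const_mul t)).aestronglyMeasurable
      (Filter.Eventually.of_forall fun ω => ?_)
    rw [Real.norm_eq_abs, Real.abs_exp, Real.exp_le_exp]
    have hle : ({i | ω ∈ E i}.ncard : ℝ) ≤ N := by
      have := Set.ncard_le_card {i | ω ∈ E i}
      rw [Nat.card_fin] at this
      exact_mod_cast this
    exact mul_le_mul (le_abs_self t) hle (Nat.cast_nonneg _) (abs_nonneg t)
  · rw [hcount, hind.mgf_sum₀ hmeas]
    calc ∏ i, mgf ((E i).indicator fun _ => (1 : ℝ)) μ t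
        ≤ ∏ _i : Fin N, Real.exp (p * (Real.exp t - 1)) := by
          refine Finset.prod_le_prod (fun i _ => mgf_nonneg) fun i _ => ?_
          rw [mgf_indicator_one (hE i), hp i, add_comm]
          exact Real.add_one_le_exp _
      _ = _ := by
          rw [Finset.prod_const, Finset.card_univ, Fintype.card_fin, ← Real.exp_nat_mul, mul_assoc]

lemma sub_two_mul_sq_le_log_one_add {s : ℝ} (hs : -(1 / 2) ≤ s) :
    s - 2 * s ^ 2 ≤ Real.log (1 + s) := by
  have h1 : 0 < 1 + s := by linarith
  refine le_trans ?_ (Real.one_sub_inv_le_log_of_pos h1)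
  rw [← sub_nonneg]
  have : 1 - (1 + s)⁻¹ - (s - 2 * s ^ 2) = s ^ 2 * (1 + 2 * s) / (1 + s) := by
    field_simp
    ring
  rw [this]
  have : 0 ≤ 1 + 2 * s := by linarith
  positivity

/-- Multiplicative Chernoff bound for the upper tail. -/
lemma measure_count_ge_le (hE : ∀ i, NullMeasurableSet (E i) μ)
    (hind : iIndepFun (fun i => (E i).indicator fun _ => (1 : ℝ)) μ)
    (hp : ∀ i, μ.real (E i) = p) {a B δ : ℝ} (hδ : 0 ≤ δ) (ha : 0 ≤ a)
    (haB : a ≤ 2 * B) (hdev : N * p + δ * B ≤ a) :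
    μ.real {ω | a ≤ ({i | ω ∈ E i}.ncard : ℝ)} ≤ Real.exp (-(δ ^ 2 * B / 16)) := by
  set s := δ / 8 with hs
  have hs0 : 0 ≤ s := by positivity
  have ht : 0 ≤ Real.log (1 + s) := Real.log_nonneg (by linarith)
  obtain ⟨hint, hmgf⟩ := mgf_count_le hE hind hp (Real.log (1 + s))
  refine (measure_ge_le_exp_mul_mgf a ht hint).trans ?_
  refine (mul_le_mul_of_nonneg_left hmgf (Real.exp_nonneg _)).trans ?_
  rw [← Real.exp_add, Real.exp_le_exp, Real.exp_log (by linarith)]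
  have h1 := mul_le_mul_of_nonneg_left
    (sub_two_mul_sq_le_log_one_add (s := s) (by linarith)) ha
  have h2 := mul_le_mul_of_nonneg_right hdev hs0
  have h3 := mul_le_mul_of_nonneg_right haB (sq_nonneg s)
  have h4 : δ = 8 * s := by rw [hs]; ring
  rw [h4] at h2 ⊢
  nlinarith

/-- Multiplicative Chernoff bound for the lower tail. -/
lemma measure_count_le_le (hE : ∀ i, NullMeasurableSet (E i) μ)
    (hind : iIndepFun (fun i => (E i).indicator fun _ => (1 : ℝ)) μ)
    (hp : ∀ i, μ.real (E i) = p) {a B δ : ℝ} (hδ : 0 ≤ δ) (hδ1 : δ ≤ 1) (ha : 0 ≤ a)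
    (haB : a ≤ 2 * B) (hdev : a + δ * B ≤ N * p) :
    μ.real {ω | ({i | ω ∈ E i}.ncard : ℝ) ≤ a} ≤ Real.exp (-(δ ^ 2 * B / 16)) := by
  set s := δ / 8 with hs
  have hs0 : 0 ≤ s := by positivity
  have ht : Real.log (1 + -s) ≤ 0 := Real.log_nonpos (by linarith) (by linarith)
  obtain ⟨hint, hmgf⟩ := mgf_count_le hE hind hp (Real.log (1 + -s))
  refine (measure_le_le_exp_mul_mgf a ht hint).trans ?_
  refine (mul_le_mul_of_nonneg_left hmgf (Real.exp_nonneg _)).trans ?_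
  rw [← Real.exp_add, Real.exp_le_exp, Real.exp_log (by linarith)]
  have h1 := mul_le_mul_of_nonneg_left
    (sub_two_mul_sq_le_log_one_add (s := -s) (by linarith)) ha
  have h2 := mul_le_mul_of_nonneg_right hdev hs0
  have h3 := mul_le_mul_of_nonneg_right haB (sq_nonneg s)
  have h4 : δ = 8 * s := by rw [hs]; ring
  rw [h4] at h2 ⊢
  nlinarith

end Sampling

section Ccdh

variable {V : Type*} [Fintype V] (G : SimpleGraph V) [DecidableRel G.Adj]

lemma ccdh_eq_ccdhR (d : ℕ) : ccdh G d = ccdhR G d := by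
  simp [ccdh, ccdhR]

lemma ccdhR_anti {s t : ℝ} (h : s ≤ t) : ccdhR G t ≤ ccdhR G s :=
  Set.ncard_le_ncard fun _ hw => h.trans hw

lemma ccdh_anti {s t : ℕ} (h : s ≤ t) : ccdh G t ≤ ccdh G s :=
  Set.ncard_le_ncard fun _ hw => h.trans hw

lemma hIndex_le_ccdh (h : 1 ≤ hIndex G) : hIndex G ≤ ccdh G (hIndex G) := by
  set F := (Finset.Icc 1 (Fintype.card V)).filter fun d => d ≤ ccdh G d with hF
  have hne : F.Nonempty := by
    by_contra hempty
    have : hIndex G = 0 := by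
      rw [hIndex, ← hF, Finset.not_nonempty_iff_eq_empty.mp hempty, Finset.sup_empty]
      rfl
    omega
  obtain ⟨d, hd, hsup⟩ := Finset.exists_mem_eq_sup F hne id
  have : hIndex G = d := hsup
  rw [this]
  exact (Finset.mem_filter.mp hd).2

lemma ncard_edgeSet_inter_mem (w : V) : (G.edgeSet ∩ {ε | w ∈ ε}).ncard = G.degree w := by
  classical
  rw [← G.card_incidenceSet_eq_degree w, ← Nat.card_eq_fintype_card]
  rfl

variable {Ω : Type*} [MeasurableSpace Ω] {μ : Measure Ω} [IsProbabilityMeasure μ]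

/-- Two-sided concentration of the number of sampled vertices of degree at least `d`. -/
lemma vertex_sample_tail {n q : ℕ} (hn : n = Fintype.card V) {v : Fin q → Ω → V}
    (hind : iIndepFun (m := fun _ => ⊤) v μ)
    (hv : ∀ i w, μ {ω | v i ω = w} = (n : ENNReal)⁻¹) (d : ℕ) {δ : ℝ} (hδ : 0 ≤ δ)
    (hδ1 : δ ≤ 1) :
    μ.real {ω | ({i | d ≤ G.degree (v i ω)}.ncard : ℝ) ≤ (1 - δ) * (q * (ccdh G d / n)) ∨
        (1 + δ) * (q * (ccdh G d / n)) ≤ ({i | d ≤ G.degree (v i ω)}.ncard : ℝ)} ≤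
      2 * Real.exp (-(δ ^ 2 * (q * (ccdh G d / n)) / 16)) := by
  set A := {w : V | d ≤ G.degree w} with hA
  have huniv : (Set.univ : Set V).ncard = n := by
    rw [Set.ncard_univ, Nat.card_eq_fintype_card, hn]
  have hpre := fun i => uniform_preimage (μ := μ) (S := (Set.univ : Set V)) Set.finite_univ
    (X := v i) (fun _ => Set.mem_univ _) (fun w _ => by rw [huniv]; exact hv i w) A
  simp only [Set.univ_inter, huniv] at hpre
  have hM : (0 : ℝ) ≤ q * (ccdh G d / n) := by positivity
  have hI := iIndepFun_indicator_preimage hind A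
  have hp : ∀ i, μ.real (v i ⁻¹' A) = ccdh G d / n := fun i => (hpre i).2
  have hlow := measure_count_le_le (fun i => (hpre i).1) hI hp
    (a := (1 - δ) * (q * (ccdh G d / n))) (B := q * (ccdh G d / n)) hδ hδ1
    (mul_nonneg (by linarith) hM) (by nlinarith) (by linarith)
  have hupp := measure_count_ge_le (fun i => (hpre i).1) hI hp
    (a := (1 + δ) * (q * (ccdh G d / n))) (B := q * (ccdh G d / n)) hδ
    (mul_nonneg (by linarith) hM) (by nlinarith) (by linarith)
  rw [two_mul]
  exact (measureReal_union_le _ _).trans (add_le_add hlow hupp)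

/-- Concentration of the number of sampled edges at a vertex `w` whose degree is separated
from `d` by a factor `1 ± δ`. -/
lemma edge_sample_tail {m r : ℕ} (hm : m = G.edgeSet.ncard) {e : Fin r → Ω → Sym2 V}
    (hind : iIndepFun (m := fun _ => ⊤) e μ) (heG : ∀ j ω, e j ω ∈ G.edgeSet)
    (he : ∀ j, ∀ ε' ∈ G.edgeSet, μ {ω | e j ω = ε'} = (m : ENNReal)⁻¹) (w : V) {d δ : ℝ}
    (hd : 0 ≤ d) (hδ : 0 ≤ δ) (hδ1 : δ ≤ 1) :
    μ.real {ω | ((G.degree w : ℝ) < (1 - δ) * d ∧ r * d / m ≤ ({j | w ∈ e j ω}.ncard : ℝ)) ∨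
        ((1 + δ) * d ≤ G.degree w ∧ ({j | w ∈ e j ω}.ncard : ℝ) ≤ r * d / m)} ≤
      Real.exp (-(δ ^ 2 * (r * d / m) / 16)) := by
  have hpre := fun j => uniform_preimage (μ := μ) G.edgeSet.toFinite (heG j)
    (fun x hx => by rw [← hm]; exact he j x hx) {ε | w ∈ ε}
  simp only [ncard_edgeSet_inter_mem, ← hm] at hpre
  have hI := iIndepFun_indicator_preimage hind {ε | w ∈ ε}
  have hp : ∀ j, μ.real (e j ⁻¹' {ε | w ∈ ε}) = G.degree w / m := fun j => (hpre j).2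
  have ha : (0 : ℝ) ≤ r * d / m := by positivity
  have hrm : (0 : ℝ) ≤ r / m := by positivity
  rcases lt_or_ge (G.degree w : ℝ) ((1 - δ) * d) with hlt | hge
  · refine le_trans (measureReal_mono ?_ (measure_ne_top _ _)) (measure_count_ge_le
      (fun j => (hpre j).1) hI hp (a := r * d / m) (B := r * d / m) hδ ha (by linarith) ?_)
    · rintro ω (h | h)
      · exact h.2
      · nlinarith [h.1]
    · have := mul_le_mul_of_nonneg_left hlt.le hrm
      calc _ = r / m * G.degree w + δ * (r * d / m) := by ring
        _ ≤ r / m * ((1 - δ) * d) + δ * (r * d / m) := by gcongr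
        _ = _ := by ring
  rcases le_or_gt ((1 + δ) * d) (G.degree w : ℝ) with hle | hgt
  · refine le_trans (measureReal_mono ?_ (measure_ne_top _ _)) (measure_count_le_le
      (fun j => (hpre j).1) hI hp (a := r * d / m) (B := r * d / m) hδ hδ1 ha (by linarith) ?_)
    · rintro ω (h | h)
      · exact absurd h.1 hge.not_gt
      · exact h.2
    · calc _ = r / m * ((1 + δ) * d) := by ring
        _ ≤ r / m * G.degree w := by gcongr
        _ = _ := by ring
  · have hempty : {ω | ((G.degree w : ℝ) < (1 - δ) * d ∧ r * d / m ≤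
        ({j | w ∈ e j ω}.ncard : ℝ)) ∨ ((1 + δ) * d ≤ G.degree w ∧
        ({j | w ∈ e j ω}.ncard : ℝ) ≤ r * d / m)} = ∅ := by
      ext ω
      simp [hge.not_gt, hgt.not_ge]
    rw [hempty, measureReal_empty]
    exact Real.exp_nonneg _

end Ccdh

/-- **Full ccdh approximation algorithm guarantee.** For a sufficiently large constant
`c > 0` there is a constant `c' > 0` such that: given `h' ∈ [h/2, h]`, sampling
`q ≥ c n ln n / (h' εR²)` vertices and `r ≥ c m ln n / (h' εD²)` edges i.i.d. uniformly,
and estimating `Ĉ(d)` by the vertex-sample estimator for `d ≤ h'` and by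
`|{v : d̂(v) ≥ d}|` for `d > h'`, with probability at least `1 - n^{-c'}` the output `Ĉ`
is an `(εD, εR)`-BMA of `C`: for every `d ∈ [n]`,
`(1-εR) C((1+εD)d) ≤ Ĉ(d) ≤ (1+εR) C((1-εD)d)`. -/
theorem ccdh_algorithm_guarantee :
    ∃ c₀ : ℝ, 0 < c₀ ∧ ∀ c : ℝ, c₀ ≤ c → ∃ c' : ℝ, 0 < c' ∧
      ∀ (V : Type) [Fintype V] (G : SimpleGraph V) [DecidableRel G.Adj] (n m : ℕ),
        n = Fintype.card V → 2 ≤ n → m = G.edgeSet.ncard → 1 ≤ m → 1 ≤ hIndex G →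
      ∀ h' : ℝ, (hIndex G : ℝ) / 2 ≤ h' → h' ≤ (hIndex G : ℝ) →
      ∀ εD εR : ℝ, 0 < εD → εD ≤ 1 / 2 → 0 < εR → εR < 1 →
      ∀ (Ω : Type) [MeasurableSpace Ω] (μ : Measure Ω) [IsProbabilityMeasure μ]
        (q r : ℕ) (v : Fin q → Ω → V) (e : Fin r → Ω → Sym2 V),
        c * n * Real.log n / (h' * εR ^ 2) ≤ q →
        c * m * Real.log n / (h' * εD ^ 2) ≤ r →
        iIndepFun (m := fun _ => ⊤) v μ →
        iIndepFun (m := fun _ => ⊤) e μ →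
        (∀ i : Fin q, ∀ w : V, μ {ω | v i ω = w} = (n : ENNReal)⁻¹) →
        (∀ j ω, e j ω ∈ G.edgeSet) →
        (∀ j : Fin r, ∀ ε' ∈ G.edgeSet, μ {ω | e j ω = ε'} = (m : ENNReal)⁻¹) →
      ∀ dhat : Ω → V → ℝ,
        (∀ ω w, dhat ω w = (m / r : ℝ) * ({j : Fin r | w ∈ e j ω}.ncard : ℝ)) →
      ∀ Chat : Ω → ℕ → ℝ,
        (∀ ω (d : ℕ), (d : ℝ) ≤ h' →
          Chat ω d = (n / q : ℝ) * ({i : Fin q | d ≤ G.degree (v i ω)}.ncard : ℝ)) →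
        (∀ ω (d : ℕ), h' < (d : ℝ) →
          Chat ω d = ({w : V | (d : ℝ) ≤ dhat ω w}.ncard : ℝ)) →
      1 - (n : ℝ) ^ (-c') ≤
        (μ {ω | ∀ d : ℕ, 1 ≤ d → d ≤ n →
          (1 - εR) * (ccdhR G ((1 + εD) * d) : ℝ) ≤ Chat ω d ∧
          Chat ω d ≤ (1 + εR) * (ccdhR G ((1 - εD) * d) : ℝ)}).toReal := by
  refine ⟨48, by norm_num, fun c hc => ⟨c / 16 - 2, by linarith, ?_⟩⟩
  intro V _ G _ n m hn hn2 hm hm1 hh1 h' hh'l hh'u εD εR hD0 hD1 hR0 hR1 Ω _ μ _ q r v e hq hr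
    hvind heind hv heG he dhat hdhat Chat hClow hChigh
  have hn0 : (0 : ℝ) < n := by exact_mod_cast (by omega : 0 < n)
  have hm0 : (0 : ℝ) < m := by exact_mod_cast hm1
  have hh0 : (1 : ℝ) ≤ hIndex G := by exact_mod_cast hh1
  have hh'0 : 0 < h' := by linarith
  have hlog : 0 < Real.log n := Real.log_pos (by exact_mod_cast (by omega : 1 < n))
  have hc0 : 0 < c := by linarith
  have hq0 : (0 : ℝ) < q := lt_of_lt_of_le (by positivity) hq
  have hr0 : (0 : ℝ) < r := lt_of_lt_of_le (by positivity) hr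
  rw [div_le_iff₀ (by positivity)] at hq hr
  set K : ℝ := (n : ℝ) ^ (-(c / 16)) with hK
  have hKexp : ∀ x : ℝ, c * Real.log n ≤ x → Real.exp (-(x / 16)) ≤ K := by
    intro x hx
    rw [hK, Real.rpow_def_of_pos hn0, Real.exp_le_exp]
    linarith
  have hbad : ∀ d ∈ Finset.Icc 1 n, μ.real {ω | ¬ ((1 - εR) * (ccdhR G ((1 + εD) * d) : ℝ) ≤
      Chat ω d ∧ Chat ω d ≤ (1 + εR) * (ccdhR G ((1 - εD) * d) : ℝ))} ≤ n * K := by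
    intro d hd
    have hd1 : (1 : ℝ) ≤ d := by exact_mod_cast (Finset.mem_Icc.mp hd).1
    rcases le_or_gt (d : ℝ) h' with hdh | hdh
    · have hC : h' ≤ ccdh G d := hh'u.trans <| by
        exact_mod_cast (hIndex_le_ccdh G hh1).trans
          (ccdh_anti G (by exact_mod_cast hdh.trans hh'u))
      have hKx : Real.exp (-(εR ^ 2 * (q * (ccdh G d / n)) / 16)) ≤ K := by
        apply hKexp
        have h1 : c * n * Real.log n ≤ q * (ccdh G d * εR ^ 2) := hq.trans (by gcongr)
        rw [← mul_le_mul_iff_left₀ hn0]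
        calc c * Real.log n * n = c * n * Real.log n := by ring
          _ ≤ _ := h1
          _ = _ := by field_simp
      have htails := vertex_sample_tail G hn hvind hv d hR0.le hR1.le
      refine le_trans ?_ ((htails.trans (by gcongr : _ ≤ 2 * K)).trans ?_)
      · refine measureReal_mono (fun ω hω => ?_) (measure_ne_top _ _)
        by_contra hgood
        simp only [Set.mem_ofPred_eq, not_or, not_le] at hgood
        refine hω ?_
        rw [hClow ω d hdh]
        have hup : (ccdhR G ((1 + εD) * d) : ℝ) ≤ ccdh G d := by
          rw [ccdh_eq_ccdhR]
          exact_mod_cast ccdhR_anti G (by nlinarith)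
        have hlo : (ccdh G d : ℝ) ≤ ccdhR G ((1 - εD) * d) := by
          rw [ccdh_eq_ccdhR]
          exact_mod_cast ccdhR_anti G (by nlinarith)
        have heq : ∀ x : ℝ, (n / q : ℝ) * (x * (q * (ccdh G d / n))) = x * ccdh G d := by
          intro x
          field_simp
        have hnq : (0 : ℝ) < n / q := by positivity
        constructor
        · refine (mul_le_mul_of_nonneg_left hup (by linarith)).trans ?_
          rw [← heq]
          exact mul_le_mul_of_nonneg_left hgood.1.le hnq.le
        · refine le_trans ?_ (mul_le_mul_of_nonneg_left hlo (by linarith))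
          rw [← heq]
          exact mul_le_mul_of_nonneg_left hgood.2.le hnq.le
      · have : (2 : ℝ) ≤ n := by exact_mod_cast hn2
        have : 0 ≤ K := Real.rpow_nonneg hn0.le _
        gcongr
    · have hKx : Real.exp (-(εD ^ 2 * (r * d / m) / 16)) ≤ K := by
        apply hKexp
        have h1 : c * m * Real.log n ≤ r * (d * εD ^ 2) := hr.trans (by gcongr)
        rw [← mul_le_mul_iff_left₀ hm0]
        calc c * Real.log n * m = c * m * Real.log n := by ring
          _ ≤ _ := h1
          _ = _ := by field_simp
      have htail := fun w => (edge_sample_tail G hm heind heG he w (d := d)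
        (Nat.cast_nonneg d) hD0.le (by linarith)).trans hKx
      calc _ ≤ μ.real (⋃ w ∈ (Finset.univ : Finset V), {ω |
              ((G.degree w : ℝ) < (1 - εD) * d ∧ r * d / m ≤ ({j | w ∈ e j ω}.ncard : ℝ)) ∨
              ((1 + εD) * d ≤ G.degree w ∧ ({j | w ∈ e j ω}.ncard : ℝ) ≤ r * d / m)}) := by
            refine measureReal_mono (fun ω hω => ?_) (measure_ne_top _ _)
            by_contra hgood
            simp only [Finset.mem_univ, Set.iUnion_true, Set.mem_iUnion, Set.mem_ofPred_eq,
              not_exists, not_or, not_and, not_le] at hgood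
            refine hω ?_
            have hiff : ∀ w, (d : ℝ) ≤ dhat ω w ↔ r * d / m ≤ ({j | w ∈ e j ω}.ncard : ℝ) := by
              intro w
              rw [hdhat, div_le_iff₀ hm0, div_mul_eq_mul_div, le_div_iff₀ hr0,
                mul_comm (d : ℝ), mul_comm (m : ℝ)]
            rw [hChigh ω d hdh]
            constructor
            · have h1 : ccdhR G ((1 + εD) * d) ≤ {w : V | (d : ℝ) ≤ dhat ω w}.ncard :=
                Set.ncard_le_ncard fun w hw => (hiff w).mpr ((hgood w).2 hw).le
              have h2 : (ccdhR G ((1 + εD) * d) : ℝ) ≤ ({w : V | (d : ℝ) ≤ dhat ω w}.ncard : ℝ) := by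
                exact_mod_cast h1
              exact (mul_le_of_le_one_left (Nat.cast_nonneg _) (by linarith)).trans h2
            · have h1 : {w : V | (d : ℝ) ≤ dhat ω w}.ncard ≤ ccdhR G ((1 - εD) * d) :=
                Set.ncard_le_ncard fun w hw => by
                  by_contra hlt
                  exact (((hgood w).1 (not_le.mp hlt)).not_ge ((hiff w).mp hw))
              have h2 : ({w : V | (d : ℝ) ≤ dhat ω w}.ncard : ℝ) ≤ ccdhR G ((1 - εD) * d) := by
                exact_mod_cast h1
              exact h2.trans (le_mul_of_one_le_left (Nat.cast_nonneg _) (by linarith))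
        _ ≤ ∑ _w : V, K := (measureReal_biUnion_finset_le _ _).trans
            (Finset.sum_le_sum fun w _ => htail w)
        _ = n * K := by rw [Finset.sum_const, Finset.card_univ, ← hn, nsmul_eq_mul]
  have htotal : ∑ _d ∈ Finset.Icc 1 n, n * K = (n : ℝ) ^ (-(c / 16 - 2)) := by
    rw [Finset.sum_const, Nat.card_Icc, nsmul_eq_mul, Nat.add_sub_cancel, ← mul_assoc,
      neg_sub, sub_eq_add_neg, Real.rpow_add hn0, Real.rpow_two, sq]
  rw [← htotal, ← measureReal_def]
  set S := {ω | ∀ d : ℕ, 1 ≤ d → d ≤ n →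
          (1 - εR) * (ccdhR G ((1 + εD) * d) : ℝ) ≤ Chat ω d ∧
          Chat ω d ≤ (1 + εR) * (ccdhR G ((1 - εD) * d) : ℝ)} with hS
  have hcompl : μ.real Sᶜ ≤ ∑ _d ∈ Finset.Icc 1 n, n * K := by
    refine le_trans (measureReal_mono ?_ (measure_ne_top _ _))
      ((measureReal_biUnion_finset_le _ _).trans (Finset.sum_le_sum hbad))
    intro ω hω
    simp only [hS, Set.mem_compl_iff, Set.mem_ofPred_eq, not_forall] at hω
    obtain ⟨d, hd1, hdn, hdbad⟩ := hω
    exact Set.mem_biUnion (Finset.mem_coe.mpr (Finset.mem_Icc.mpr ⟨hd1, hdn⟩)) hdbad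
  have hone := measureReal_union_le (μ := μ) S Sᶜ
  rw [Set.union_compl_self, probReal_univ] at hone
  linarith
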